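/- Let Γ be a nonlinear connection on J^1(R,M). (i) The nine local coefficient families (Ḡ^1_{11}, G^k_{i1}, G^{(k)(1)}_{(1)(i)1}, L̄^1_{1j}, L^k_{ij}, L^{(k)(1)}_{(1)(i)j}, C̄^{1(1)}_{1(j)}, C^{k(1)}_{i(j)}, C^{(k)(1)(1)}_{(1)(i)(j)}) of any Γ-linear connection ∇ on J^1(R,M) transform under the induced jet coordinate change by the rules: Ḡ^1_{11}(dt̃/dt) = Ḡ̃^1_{11}(dt̃/dt)² + d²t̃/dt²; G^k_{i1} = G̃^m_{j1}(∂x^k/∂x̃^m)(∂x̃^j/∂x^i)(dt̃/dt); G^{(k)(1)}_{(1)(i)1} = G̃^{(m)(1)}_{(1)(j)1}(∂x^k/∂x̃^m)(∂x̃^j/∂x^i)(dt̃/dt) + δ^k_i(dt̃/dt)²(d²t/dt̃²); L̄^1_{1j}(∂x^j/∂x̃^l) = L̄̃^1_{1l}; L^m_{ij}(∂x̃^r/∂x^m) = L̃^r_{pq}(∂x̃^p/∂x^i)(∂x̃^q/∂x^j) + ∂²x̃^r/∂x^i∂x^j; L^{(m)(1)}_{(1)(i)j}(∂x̃^r/∂x^m)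 = L̃^{(r)(1)}_{(1)(p)q}(∂x̃^p/∂x^i)(∂x̃^q/∂x^j) + ∂²x̃^r/∂x^i∂x^j; C̄^{1(1)}_{1(i)} = C̄̃^{1(1)}_{1(j)}(∂x̃^j/∂x^i)(dt/dt̃); C^{k(1)}_{i(j)} = C̃^{s(1)}_{p(r)}(∂x^k/∂x̃^s)(∂x̃^p/∂x^i)(∂x̃^r/∂x^j)(dt/dt̃); C^{(k)(1)(1)}_{(1)(i)(j)} = C̃^{(r)(1)(1)}_{(1)(p)(q)}(∂x^k/∂x̃^r)(∂x̃^p/∂x^i)(∂x̃^q/∂x^j)(dt/dt̃). (ii) Conversely, any set of nine local coefficient families with these transformation laws determines a Γ-linear connection on J^1(R,M). -/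

import Mathlib

noncomputable section

open scoped BigOperators

/-- Local spatial coordinates (fibre ℝⁿ). -/
abbrev Vec (n : ℕ) : Type := Fin n → ℝ

/-- Local coordinates `(t, xⁱ, yⁱ)` on the 1-jet bundle `J¹(ℝ, M)`. -/
abbrev J1 (n : ℕ) : Type := ℝ × Vec n × Vec n

namespace Jet

variable {n : ℕ}

/-- Partial derivative in the temporal variable `t`. -/
def pt (f : J1 n → ℝ) (p : J1 n) : ℝ := deriv (fun s => f (s, p.2)) p.1

/-- Partial derivative in the spatial variable `x^j`. -/
def px (f : J1 n → ℝ) (j : Fin n) (p : J1 n) : ℝ :=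
  deriv (fun s => f (p.1, Function.update p.2.1 j s, p.2.2)) (p.2.1 j)

/-- Partial derivative in the fibre variable `y^j`. -/
def py (f : J1 n → ℝ) (j : Fin n) (p : J1 n) : ℝ :=
  deriv (fun s => f (p.1, p.2.1, Function.update p.2.2 j s)) (p.2.2 j)

/-- Partial derivative of a function of the spatial variables only. -/
def pX (f : Vec n → ℝ) (j : Fin n) (x : Vec n) : ℝ :=
  deriv (fun s => f (Function.update x j s)) (x j)

/-- A change of coordinates `t̃ = t̃(t)`, `x̃ⁱ = x̃ⁱ(xʲ)` on the base `ℝ × M`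
(a gauge transformation of the bundle of configurations). -/
structure CoordChange (n : ℕ) where
  τ : ℝ → ℝ
  τinv : ℝ → ℝ
  σ : Vec n → Vec n
  σinv : Vec n → Vec n
  left_τ : Function.LeftInverse τinv τ
  right_τ : Function.RightInverse τinv τ
  left_σ : Function.LeftInverse σinv σ
  right_σ : Function.RightInverse σinv σ
  smooth_τ : ContDiff ℝ (⊤ : ℕ∞) τ
  smooth_τinv : ContDiff ℝ (⊤ : ℕ∞) τinv
  smooth_σ : ContDiff ℝ (⊤ : ℕ∞) σ
  smooth_σinv : ContDiff ℝ (⊤ : ℕ∞) σinv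

namespace CoordChange

variable (c : CoordChange n)

/-- `dt̃/dt`. -/
def dτ (t : ℝ) : ℝ := deriv c.τ t

/-- `dt/dt̃`, evaluated at `t̃ = τ t`. -/
def dτinv (t : ℝ) : ℝ := deriv c.τinv (c.τ t)

/-- The Jacobian `∂x̃^k/∂x^j`. -/
def Jac (k j : Fin n) (x : Vec n) : ℝ := pX (fun z => c.σ z k) j x

/-- The inverse Jacobian `∂x^i/∂x̃^j`, evaluated at `x̃ = σ x`. -/
def JacInv (i j : Fin n) (x : Vec n) : ℝ := pX (fun z => c.σinv z i) j (c.σ x)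

/-- The induced change of the fibre coordinates:
`ỹⁱ = (∂x̃ⁱ/∂xʲ)(dt/dt̃) yʲ`. -/
def yc (p : J1 n) : Vec n := fun i => (∑ j, c.Jac i j p.2.1 * p.2.2 j) * c.dτinv p.1

/-- The induced change of coordinates on `J¹(ℝ,M)`. -/
def Φ (p : J1 n) : J1 n := (c.τ p.1, c.σ p.2.1, c.yc p)

end CoordChange

/-- The transformation law of the local components of a temporal spray:
`2H̃⁽ᵏ⁾ = 2H⁽ʲ⁾ (dt/dt̃)² (∂x̃ᵏ/∂xʲ) − (dt/dt̃)(∂ỹᵏ/∂t)`. -/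
def TemporalSprayLaw (c : CoordChange n) (H H' : J1 n → Fin n → ℝ) : Prop :=
  ∀ (p : J1 n) (k : Fin n),
    2 * H' (c.Φ p) k =
      (∑ j, 2 * H p j * (c.dτinv p.1) ^ 2 * c.Jac k j p.2.1) -
        c.dτinv p.1 * pt (fun q => c.yc q k) p

/-- The transformation law of the local components of a spatial spray:
`2G̃⁽ᵏ⁾ = 2G⁽ʲ⁾ (dt/dt̃)² (∂x̃ᵏ/∂xʲ) − (∂xⁱ/∂x̃ʲ)(∂ỹᵏ/∂xⁱ) ỹʲ`. -/
def SpatialSprayLaw (c : CoordChange n) (G G' : J1 n → Fin n → ℝ) : Prop :=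
  ∀ (p : J1 n) (k : Fin n),
    2 * G' (c.Φ p) k =
      (∑ j, 2 * G p j * (c.dτinv p.1) ^ 2 * c.Jac k j p.2.1) -
        ∑ j, ∑ i, c.JacInv i j p.2.1 * px (fun q => c.yc q k) i p * c.yc p j

/-- The transformation law of a temporal nonlinear connection:
`M̃⁽ʲ⁾(dt̃/dt) = M⁽ᵏ⁾(dt/dt̃)(∂x̃ʲ/∂xᵏ) − ∂ỹʲ/∂t`. -/
def TemporalNLCLaw (c : CoordChange n) (M M' : J1 n → Fin n → ℝ) : Prop :=
  ∀ (p : J1 n) (j : Fin n),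
    M' (c.Φ p) j * c.dτ p.1 =
      (∑ k, M p k * c.dτinv p.1 * c.Jac j k p.2.1) - pt (fun q => c.yc q j) p

/-- The transformation law of a spatial nonlinear connection:
`Ñ⁽ʲ⁾₍ₖ₎(∂x̃ᵏ/∂xⁱ) = N⁽ᵏ⁾₍ᵢ₎(dt/dt̃)(∂x̃ʲ/∂xᵏ) − ∂ỹʲ/∂xⁱ`. -/
def SpatialNLCLaw (c : CoordChange n) (N N' : J1 n → Fin n → Fin n → ℝ) : Prop :=
  ∀ (p : J1 n) (j i : Fin n),
    (∑ k, N' (c.Φ p) j k * c.Jac k i p.2.1) =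
      (∑ k, N p k i * c.dτinv p.1 * c.Jac j k p.2.1) - px (fun q => c.yc q j) i p

/-- Transformation law of a (semi-Riemannian) temporal metric `h₁₁(t)`. -/
def TemporalMetricLaw (c : CoordChange n) (h h' : ℝ → ℝ) : Prop :=
  ∀ t : ℝ, h' (c.τ t) = h t * (c.dτinv t) ^ 2

/-- Transformation law of a (semi-Riemannian) spatial metric `φᵢⱼ(x)`. -/
def SpatialMetricLaw (c : CoordChange n) (φ φ' : Vec n → Matrix (Fin n) (Fin n) ℝ) : Prop :=
  ∀ (x : Vec n) (i j : Fin n),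
    φ' (c.σ x) i j = ∑ k, ∑ l, φ x k l * c.JacInv k i x * c.JacInv l j x

/-- The Christoffel symbol `H¹₁₁ = (h¹¹/2) dh₁₁/dt` of a temporal metric. -/
def christoffelT (h : ℝ → ℝ) (t : ℝ) : ℝ := deriv h t / (2 * h t)

/-- The Christoffel symbols `γⁱⱼₖ` of a spatial metric `φ`. -/
def christoffelS (φ : Vec n → Matrix (Fin n) (Fin n) ℝ) (i j k : Fin n) (x : Vec n) : ℝ :=
  (1 / 2) * ∑ m, (φ x)⁻¹ i m *
    (pX (fun z => φ z m j) k x + pX (fun z => φ z m k) j x - pX (fun z => φ z j k) m x)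

/-- The adapted temporal derivative `δf/δt = ∂f/∂t − M⁽ʲ⁾₍₁₎₁ ∂f/∂yʲ`. -/
def deltaT {n : ℕ} (M : J1 n → Fin n → ℝ) (f : J1 n → ℝ) (p : J1 n) : ℝ :=
  pt f p - ∑ j, M p j * py f j p

/-- The adapted spatial derivative `δf/δxᵏ = ∂f/∂xᵏ − N⁽ʲ⁾₍₁₎ₖ ∂f/∂yʲ`. -/
def deltaX {n : ℕ} (N : J1 n → Fin n → Fin n → ℝ) (f : J1 n → ℝ) (k : Fin n)
    (p : J1 n) : ℝ :=
  px f k p - ∑ j, N p j k * py f j p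

/-- The nine local coefficient families of a `Γ`-linear connection `∇` on `J¹(ℝ,M)`:
`∇Γ = (Ḡ¹₁₁, Gᵏᵢ₁, G⁽ᵏ⁾⁽¹⁾₍₁₎₍ᵢ₎₁, L̄¹₁ⱼ, Lᵏᵢⱼ, L⁽ᵏ⁾⁽¹⁾₍₁₎₍ᵢ₎ⱼ, C̄¹⁽¹⁾₁₍ⱼ₎, Cᵏ⁽¹⁾ᵢ₍ⱼ₎,
C⁽ᵏ⁾⁽¹⁾⁽¹⁾₍₁₎₍ᵢ₎₍ⱼ₎)`. -/
structure GammaCoeffs (n : ℕ) where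
  Gbar : J1 n → ℝ
  Gc : J1 n → Fin n → Fin n → ℝ
  Gv : J1 n → Fin n → Fin n → ℝ
  Lbar : J1 n → Fin n → ℝ
  Lc : J1 n → Fin n → Fin n → Fin n → ℝ
  Lv : J1 n → Fin n → Fin n → Fin n → ℝ
  Cbar : J1 n → Fin n → ℝ
  Cc : J1 n → Fin n → Fin n → Fin n → ℝ
  Cv : J1 n → Fin n → Fin n → Fin n → ℝ

/-- Smoothness of the nine coefficient families. -/
def SmoothCoeffs {n : ℕ} (Γ : GammaCoeffs n) : Prop :=
  ContDiff ℝ (⊤ : ℕ∞) Γ.Gbar ∧ (∀ k i, ContDiff ℝ (⊤ : ℕ∞) (fun p => Γ.Gc p k i)) ∧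
  (∀ k i, ContDiff ℝ (⊤ : ℕ∞) (fun p => Γ.Gv p k i)) ∧ (∀ j, ContDiff ℝ (⊤ : ℕ∞) (fun p => Γ.Lbar p j)) ∧
  (∀ k i j, ContDiff ℝ (⊤ : ℕ∞) (fun p => Γ.Lc p k i j)) ∧
  (∀ k i j, ContDiff ℝ (⊤ : ℕ∞) (fun p => Γ.Lv p k i j)) ∧
  (∀ j, ContDiff ℝ (⊤ : ℕ∞) (fun p => Γ.Cbar p j)) ∧
  (∀ k i j, ContDiff ℝ (⊤ : ℕ∞) (fun p => Γ.Cc p k i j)) ∧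
  (∀ k i j, ContDiff ℝ (⊤ : ℕ∞) (fun p => Γ.Cv p k i j))

/-- `d²t̃/dt²`. -/
def d2τ {n : ℕ} (c : CoordChange n) (t : ℝ) : ℝ := deriv (deriv c.τ) t

/-- `d²t/dt̃²`, evaluated at `t̃ = τ t`. -/
def d2τinv {n : ℕ} (c : CoordChange n) (t : ℝ) : ℝ := deriv (deriv c.τinv) (c.τ t)

/-- `∂²x̃ʳ/∂xⁱ∂xʲ`. -/
def d2σ {n : ℕ} (c : CoordChange n) (r i j : Fin n) (x : Vec n) : ℝ :=
  pX (fun z => pX (fun w => c.σ w r) i z) j x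

/-- The nine transformation laws of the coefficients of a `Γ`-linear connection. -/
def GammaLaws {n : ℕ} (c : CoordChange n) (Γ Γ' : GammaCoeffs n) : Prop :=
  (∀ p : J1 n,
    Γ.Gbar p * c.dτ p.1 = Γ'.Gbar (c.Φ p) * (c.dτ p.1) ^ 2 + d2τ c p.1) ∧
  (∀ (p : J1 n) (k i : Fin n),
    Γ.Gc p k i =
      ∑ m, ∑ j, Γ'.Gc (c.Φ p) m j * c.JacInv k m p.2.1 * c.Jac j i p.2.1 * c.dτ p.1) ∧
  (∀ (p : J1 n) (k i : Fin n),
    Γ.Gv p k i =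
      (∑ m, ∑ j, Γ'.Gv (c.Φ p) m j * c.JacInv k m p.2.1 * c.Jac j i p.2.1 * c.dτ p.1) +
        (if k = i then 1 else 0) * (c.dτ p.1) ^ 2 * d2τinv c p.1) ∧
  (∀ (p : J1 n) (l : Fin n),
    (∑ j, Γ.Lbar p j * c.JacInv j l p.2.1) = Γ'.Lbar (c.Φ p) l) ∧
  (∀ (p : J1 n) (r i j : Fin n),
    (∑ m, Γ.Lc p m i j * c.Jac r m p.2.1) =
      (∑ s, ∑ q, Γ'.Lc (c.Φ p) r s q * c.Jac s i p.2.1 * c.Jac q j p.2.1) +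
        d2σ c r i j p.2.1) ∧
  (∀ (p : J1 n) (r i j : Fin n),
    (∑ m, Γ.Lv p m i j * c.Jac r m p.2.1) =
      (∑ s, ∑ q, Γ'.Lv (c.Φ p) r s q * c.Jac s i p.2.1 * c.Jac q j p.2.1) +
        d2σ c r i j p.2.1) ∧
  (∀ (p : J1 n) (i : Fin n),
    Γ.Cbar p i = ∑ j, Γ'.Cbar (c.Φ p) j * c.Jac j i p.2.1 * c.dτinv p.1) ∧
  (∀ (p : J1 n) (k i j : Fin n),
    Γ.Cc p k i j =
      ∑ s, ∑ q, ∑ r, Γ'.Cc (c.Φ p) s q r * c.JacInv k s p.2.1 * c.Jac q i p.2.1 *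
        c.Jac r j p.2.1 * c.dτinv p.1) ∧
  (∀ (p : J1 n) (k i j : Fin n),
    Γ.Cv p k i j =
      ∑ s, ∑ q, ∑ r, Γ'.Cv (c.Φ p) s q r * c.JacInv k s p.2.1 * c.Jac q i p.2.1 *
        c.Jac r j p.2.1 * c.dτinv p.1)

/-- The covariant derivative `∇_{δ/δt} W` of a vector field `W`, written in adapted
components, of a `Γ`-linear connection with coefficients `Γ`. -/
def covT {n : ℕ} (M : J1 n → Fin n → ℝ) (Γ : GammaCoeffs n) (W : J1 n → J1 n)
    (p : J1 n) : J1 n :=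
  (deltaT M (fun q => (W q).1) p + (W p).1 * Γ.Gbar p,
   fun k => deltaT M (fun q => (W q).2.1 k) p + ∑ i, (W p).2.1 i * Γ.Gc p k i,
   fun k => deltaT M (fun q => (W q).2.2 k) p + ∑ i, (W p).2.2 i * Γ.Gv p k i)

/-- `∇_{δ/δxʲ} W` in adapted components. -/
def covX {n : ℕ} (N : J1 n → Fin n → Fin n → ℝ) (Γ : GammaCoeffs n) (W : J1 n → J1 n)
    (j : Fin n) (p : J1 n) : J1 n :=
  (deltaX N (fun q => (W q).1) j p + (W p).1 * Γ.Lbar p j,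
   fun k => deltaX N (fun q => (W q).2.1 k) j p + ∑ i, (W p).2.1 i * Γ.Lc p k i j,
   fun k => deltaX N (fun q => (W q).2.2 k) j p + ∑ i, (W p).2.2 i * Γ.Lv p k i j)

/-- `∇_{∂/∂yʲ} W` in adapted components. -/
def covY {n : ℕ} (Γ : GammaCoeffs n) (W : J1 n → J1 n) (j : Fin n) (p : J1 n) : J1 n :=
  (py (fun q => (W q).1) j p + (W p).1 * Γ.Cbar p j,
   fun k => py (fun q => (W q).2.1 k) j p + ∑ i, (W p).2.1 i * Γ.Cc p k i j,
   fun k => py (fun q => (W q).2.2 k) j p + ∑ i, (W p).2.2 i * Γ.Cv p k i j)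

/-- The change of adapted-frame components induced by the coordinate change: the adapted
frames transform by `δ/δt = (dt̃/dt)δ/δt̃`, `δ/δxⁱ = (∂x̃ᵏ/∂xⁱ)δ/δx̃ᵏ`,
`∂/∂yⁱ = (∂x̃ᵏ/∂xⁱ)(dt/dt̃)∂/∂ỹᵏ`. -/
def adMap {n : ℕ} (c : CoordChange n) (p : J1 n) (w : J1 n) : J1 n :=
  (c.dτ p.1 * w.1,
   fun k => ∑ i, c.Jac k i p.2.1 * w.2.1 i,
   fun k => ∑ i, c.Jac k i p.2.1 * c.dτinv p.1 * w.2.2 i)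

/-- The inverse of the induced change of coordinates on `J¹(ℝ,M)`. -/
def Φinv {n : ℕ} (c : CoordChange n) (q : J1 n) : J1 n :=
  (c.τinv q.1, c.σinv q.2.1,
   fun i => (∑ j, pX (fun z => c.σinv z i) j q.2.1 * q.2.2 j) * deriv c.τ (c.τinv q.1))

/-- The adapted components, in the new chart, of the vector field with adapted components
`W` in the old chart. -/
def pushVF {n : ℕ} (c : CoordChange n) (W : J1 n → J1 n) (q : J1 n) : J1 n :=
  adMap c (Φinv c q) (W (Φinv c q))

/-- Two families of nine coefficients, in the two charts, represent the *same* `Γ`-linear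
connection `∇` when, for every smooth vector field (given by its adapted components `W`),
the covariant derivatives computed in the two charts correspond to each other under the
adapted-frame transformation. -/
def SameConnection {n : ℕ} (c : CoordChange n) (M : J1 n → Fin n → ℝ)
    (N : J1 n → Fin n → Fin n → ℝ) (M' : J1 n → Fin n → ℝ)
    (N' : J1 n → Fin n → Fin n → ℝ) (Γ Γ' : GammaCoeffs n) : Prop :=
  ∀ W : J1 n → J1 n, ContDiff ℝ (⊤ : ℕ∞) W →
    (∀ p : J1 n,
      adMap c p (covT M Γ W p) = c.dτ p.1 • covT M' Γ' (pushVF c W) (c.Φ p)) ∧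
    (∀ (p : J1 n) (i : Fin n),
      adMap c p (covX N Γ W i p) =
        ∑ j, c.Jac j i p.2.1 • covX N' Γ' (pushVF c W) j (c.Φ p)) ∧
    (∀ (p : J1 n) (i : Fin n),
      adMap c p (covY Γ W i p) =
        ∑ j, (c.Jac j i p.2.1 * c.dτinv p.1) • covY Γ' (pushVF c W) j (c.Φ p))

section Partials

theorem pt_eq_fderiv {n : ℕ} {f : J1 n → ℝ} {p : J1 n} (hf : DifferentiableAt ℝ f p) :
    pt f p = fderiv ℝ f p (1, 0, 0) := by
  have h : HasDerivAt (fun s : ℝ => ((s, p.2) : J1 n)) (1, 0) p.1 :=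
    (hasDerivAt_id p.1).prodMk (hasDerivAt_const p.1 p.2)
  exact (hf.hasFDerivAt.comp_hasDerivAt_of_eq p.1 h rfl).deriv

theorem px_eq_fderiv {n : ℕ} {f : J1 n → ℝ} {p : J1 n} (hf : DifferentiableAt ℝ f p)
    (j : Fin n) : px f j p = fderiv ℝ f p (0, Pi.single j 1, 0) := by
  have h : HasDerivAt (fun s : ℝ => ((p.1, Function.update p.2.1 j s, p.2.2) : J1 n))
      (0, Pi.single j 1, 0) (p.2.1 j) :=
    (hasDerivAt_const _ _).prodMk ((hasDerivAt_update p.2.1 j _).prodMk (hasDerivAt_const _ _))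
  exact (hf.hasFDerivAt.comp_hasDerivAt_of_eq _ h (by simp)).deriv

theorem py_eq_fderiv {n : ℕ} {f : J1 n → ℝ} {p : J1 n} (hf : DifferentiableAt ℝ f p)
    (j : Fin n) : py f j p = fderiv ℝ f p (0, 0, Pi.single j 1) := by
  have h : HasDerivAt (fun s : ℝ => ((p.1, p.2.1, Function.update p.2.2 j s) : J1 n))
      (0, 0, Pi.single j 1) (p.2.2 j) :=
    (hasDerivAt_const _ _).prodMk ((hasDerivAt_const _ _).prodMk (hasDerivAt_update p.2.2 j _))
  exact (hf.hasFDerivAt.comp_hasDerivAt_of_eq _ h (by simp)).deriv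

theorem pX_eq_fderiv {n : ℕ} {f : Vec n → ℝ} {x : Vec n} (hf : DifferentiableAt ℝ f x)
    (j : Fin n) : pX f j x = fderiv ℝ f x (Pi.single j 1) :=
  (hf.hasFDerivAt.comp_hasDerivAt_of_eq _ (hasDerivAt_update x j _) (by simp)).deriv

theorem contDiff_pX {n : ℕ} {f : Vec n → ℝ} (hf : ContDiff ℝ (⊤ : ℕ∞) f) (j : Fin n) :
    ContDiff ℝ (⊤ : ℕ∞) (fun x => pX f j x) := by
  have h : (fun x => pX f j x) = fun x => fderiv ℝ f x (Pi.single j 1) :=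
    funext fun x => pX_eq_fderiv (hf.differentiable (by simp) x) j
  rw [h]
  exact (hf.fderiv_right (by simp)).clm_apply contDiff_const

theorem fderiv_apply_eq_sum_pX {n : ℕ} {f : Vec n → ℝ} {x : Vec n}
    (hf : DifferentiableAt ℝ f x) (v : Vec n) :
    fderiv ℝ f x v = ∑ j, pX f j x * v j := by
  conv_lhs => rw [pi_eq_sum_univ' v]
  simp [map_sum, pX_eq_fderiv hf, mul_comm]

/-- Standard-frame components of `δ/δt`. -/
def frameT {n : ℕ} (M : J1 n → Fin n → ℝ) (p : J1 n) : J1 n := (1, 0, fun j => -M p j)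

/-- Standard-frame components of `δ/δxⁱ`. -/
def frameX {n : ℕ} (N : J1 n → Fin n → Fin n → ℝ) (i : Fin n) (p : J1 n) : J1 n :=
  (0, Pi.single i 1, fun j => -N p j i)

/-- Standard-frame components of `∂/∂yⁱ`. -/
def frameY {n : ℕ} (i : Fin n) : J1 n := (0, 0, Pi.single i 1)

theorem fderiv_vertical {n : ℕ} {f : J1 n → ℝ} {p : J1 n} (hf : DifferentiableAt ℝ f p)
    (v : Vec n) : fderiv ℝ f p (0, 0, v) = ∑ j, v j * py f j p := by
  have h : ((0, 0, v) : J1 n) = ∑ j, v j • ((0, 0, Pi.single j 1) : J1 n) := by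
    refine Prod.ext ?_ (Prod.ext ?_ ?_)
    · simp [Prod.fst_sum]
    · simp [Prod.snd_sum, Prod.fst_sum]
    · simp only [Prod.snd_sum, Prod.smul_snd]
      exact pi_eq_sum_univ' v
  rw [h, map_sum]
  simp only [map_smul, smul_eq_mul, py_eq_fderiv hf]

theorem deltaT_eq_fderiv {n : ℕ} {f : J1 n → ℝ} {p : J1 n} (hf : DifferentiableAt ℝ f p)
    (M : J1 n → Fin n → ℝ) : deltaT M f p = fderiv ℝ f p (frameT M p) := by
  have h : frameT M p = (1, 0, 0) + (0, 0, fun j => -M p j) := by simp [frameT]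
  rw [h, map_add, fderiv_vertical hf, deltaT, pt_eq_fderiv hf]
  simp [sub_eq_add_neg]

theorem deltaX_eq_fderiv {n : ℕ} {f : J1 n → ℝ} {p : J1 n} (hf : DifferentiableAt ℝ f p)
    (N : J1 n → Fin n → Fin n → ℝ) (i : Fin n) :
    deltaX N f i p = fderiv ℝ f p (frameX N i p) := by
  have h : frameX N i p = (0, Pi.single i 1, 0) + (0, 0, fun j => -N p j i) := by simp [frameX]
  rw [h, map_add, fderiv_vertical hf, deltaX, px_eq_fderiv hf]
  simp [sub_eq_add_neg]

end Partials

section Coordinates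

variable {n : ℕ} (c : CoordChange n)

theorem contDiff_comp_σ (k : Fin n) : ContDiff ℝ (⊤ : ℕ∞) (fun x => c.σ x k) :=
  contDiff_pi.1 c.smooth_σ k

theorem contDiff_Jac (k j : Fin n) : ContDiff ℝ (⊤ : ℕ∞) (c.Jac k j) :=
  contDiff_pX (contDiff_comp_σ c k) j

theorem contDiff_dτ : ContDiff ℝ (⊤ : ℕ∞) c.dτ :=
  (contDiff_infty_iff_deriv.1 c.smooth_τ).2

theorem contDiff_deriv_τinv : ContDiff ℝ (⊤ : ℕ∞) (deriv c.τinv) :=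
  (contDiff_infty_iff_deriv.1 c.smooth_τinv).2

theorem contDiff_dτinv : ContDiff ℝ (⊤ : ℕ∞) c.dτinv :=
  (contDiff_deriv_τinv c).comp c.smooth_τ

theorem hasDerivAt_dτinv (t : ℝ) : HasDerivAt c.dτinv (d2τinv c t * c.dτ t) t :=
  HasDerivAt.comp t ((contDiff_deriv_τinv c).differentiable (by simp) (c.τ t)).hasDerivAt
    (c.smooth_τ.differentiable (by simp) t).hasDerivAt

theorem dτinv_mul_dτ (t : ℝ) : c.dτinv t * c.dτ t = 1 := by
  have h := HasDerivAt.comp t (c.smooth_τinv.differentiable (by simp) (c.τ t)).hasDerivAt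
    (c.smooth_τ.differentiable (by simp) t).hasDerivAt
  have e : c.τinv ∘ c.τ = id := funext c.left_τ
  rw [e] at h
  exact h.unique (hasDerivAt_id t)

theorem JacInv_mul_Jac (x : Vec n) :
    (Matrix.of fun i j => c.JacInv i j x) * (Matrix.of fun i j => c.Jac i j x) = 1 := by
  ext i l
  have h := HasFDerivAt.comp x
    ((contDiff_pi.1 c.smooth_σinv i).differentiable (by simp) (c.σ x)).hasFDerivAt
    (c.smooth_σ.differentiable (by simp) x).hasFDerivAt
  have e : (fun z => c.σinv z i) ∘ c.σ = ContinuousLinearMap.proj (R := ℝ) i := by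
    funext z
    simp [c.left_σ z]
  rw [e] at h
  have h2 := DFunLike.congr_fun (h.unique (ContinuousLinearMap.hasFDerivAt _))
    (Pi.single l (1 : ℝ))
  simp only [ContinuousLinearMap.comp_apply, ContinuousLinearMap.proj_apply] at h2
  rw [fderiv_apply_eq_sum_pX
    ((contDiff_pi.1 c.smooth_σinv i).differentiable (by simp) (c.σ x))] at h2
  rw [Matrix.mul_apply, Matrix.one_apply]
  simp only [Pi.single_apply] at h2
  rw [← h2]
  refine Finset.sum_congr rfl fun j _ => ?_
  simp only [Matrix.of_apply, CoordChange.JacInv, CoordChange.Jac]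
  rw [pX_eq_fderiv ((contDiff_comp_σ c j).differentiable (by simp) x),
    fderiv_apply (c.smooth_σ.differentiable (by simp) x)]
  rfl

theorem Φinv_Φ (p : J1 n) : Φinv c (c.Φ p) = p := by
  obtain ⟨t, x, y⟩ := p
  refine Prod.ext (c.left_τ t) (Prod.ext (c.left_σ x) (funext fun i => ?_))
  simp only [Φinv, CoordChange.Φ, CoordChange.yc, c.left_τ t]
  have h := congrFun (congrArg (fun A => A.mulVec y) (JacInv_mul_Jac c x)) i
  simp only [← Matrix.mulVec_mulVec, Matrix.one_mulVec] at h
  simp only [Matrix.mulVec, dotProduct, Matrix.of_apply, CoordChange.JacInv] at h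
  conv_rhs => rw [← h]
  simp only [← mul_assoc, ← Finset.sum_mul]
  have := dτinv_mul_dτ c t
  rw [mul_assoc _ (c.dτinv t)]
  erw [this]
  simp [Finset.mul_sum]

theorem contDiff_yc (k : Fin n) : ContDiff ℝ (⊤ : ℕ∞) (fun p => c.yc p k) := by
  have h1 := fun j => contDiff_Jac c k j
  have h2 := contDiff_dτinv c
  unfold CoordChange.yc
  fun_prop

theorem contDiff_Φ : ContDiff ℝ (⊤ : ℕ∞) c.Φ := by
  have h1 := c.smooth_τ
  have h2 := c.smooth_σ
  exact (h1.comp contDiff_fst).prodMk ((h2.comp (contDiff_fst.comp contDiff_snd)).prodMk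
    (contDiff_pi.2 (contDiff_yc c)))

theorem contDiff_Φinv : ContDiff ℝ (⊤ : ℕ∞) (Φinv c) := by
  have h1 := c.smooth_τinv
  have h2 := c.smooth_σinv
  have h3 := contDiff_dτ c
  have h4 := fun i j => contDiff_pX (contDiff_pi.1 c.smooth_σinv i) j
  refine (h1.comp contDiff_fst).prodMk ((h2.comp (contDiff_fst.comp contDiff_snd)).prodMk
    (contDiff_pi.2 fun i => ?_))
  change ContDiff ℝ _ (fun q : J1 n => (∑ j, (fun x => pX (fun z => c.σinv z i) j x) q.2.1 *
    q.2.2 j) * c.dτ (c.τinv q.1))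
  fun_prop

theorem contDiff_adMap {W : J1 n → J1 n} (hW : ContDiff ℝ (⊤ : ℕ∞) W) :
    ContDiff ℝ (⊤ : ℕ∞) (fun q => adMap c q (W q)) := by
  have h1 := contDiff_Jac c
  have h2 := contDiff_dτ c
  have h3 := contDiff_dτinv c
  unfold adMap
  fun_prop

theorem contDiff_pushVF {W : J1 n → J1 n} (hW : ContDiff ℝ (⊤ : ℕ∞) W) :
    ContDiff ℝ (⊤ : ℕ∞) (pushVF c W) :=
  (contDiff_adMap c hW).comp (contDiff_Φinv c)

theorem pushVF_Φ (W : J1 n → J1 n) (p : J1 n) : pushVF c W (c.Φ p) = adMap c p (W p) := by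
  simp [pushVF, Φinv_Φ]

theorem fderiv_dτ (p v : J1 n) :
    fderiv ℝ (fun q : J1 n => c.dτ q.1) p v = d2τ c p.1 * v.1 := by
  have h := HasDerivAt.comp_hasFDerivAt p
    ((contDiff_dτ c).differentiable (by simp) p.1).hasDerivAt
    (hasFDerivAt_fst (𝕜 := ℝ) (p := p))
  rw [show (fun q : J1 n => c.dτ q.1) = c.dτ ∘ Prod.fst from rfl, h.fderiv]
  exact rfl

theorem fderiv_dτinv (p v : J1 n) :
    fderiv ℝ (fun q : J1 n => c.dτinv q.1) p v = d2τinv c p.1 * c.dτ p.1 * v.1 := by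
  have h := HasDerivAt.comp_hasFDerivAt p (hasDerivAt_dτinv c p.1)
    (hasFDerivAt_fst (𝕜 := ℝ) (p := p))
  rw [show (fun q : J1 n => c.dτinv q.1) = c.dτinv ∘ Prod.fst from rfl, h.fderiv]
  simp

theorem fderiv_comp_space {f : Vec n → ℝ} (hf : ContDiff ℝ (⊤ : ℕ∞) f) (p v : J1 n) :
    fderiv ℝ (fun q : J1 n => f q.2.1) p v = ∑ j, pX f j p.2.1 * v.2.1 j := by
  have hd := hf.differentiable (by simp) p.2.1
  have h := HasFDerivAt.comp p hd.hasFDerivAt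
    ((hasFDerivAt_snd (𝕜 := ℝ) (p := p)).fst)
  rw [show (fun q : J1 n => f q.2.1) = f ∘ fun q => q.2.1 from rfl, h.fderiv,
    ← fderiv_apply_eq_sum_pX hd]
  simp

theorem fderiv_Jac (k s : Fin n) (p v : J1 n) :
    fderiv ℝ (fun q : J1 n => c.Jac k s q.2.1) p v = ∑ j, d2σ c k s j p.2.1 * v.2.1 j :=
  fderiv_comp_space (contDiff_Jac c k s) p v

theorem py_yc (k j : Fin n) (p : J1 n) :
    py (fun q => c.yc q k) j p = c.Jac k j p.2.1 * c.dτinv p.1 := by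
  unfold py CoordChange.yc
  have h : HasDerivAt (fun s : ℝ => (∑ l, c.Jac k l p.2.1 * Function.update p.2.2 j s l) *
      c.dτinv p.1) ((∑ l, c.Jac k l p.2.1 * (Pi.single j 1 : Vec n) l) * c.dτinv p.1)
      (p.2.2 j) :=
    (HasDerivAt.fun_sum fun l _ =>
      (hasDerivAt_pi.1 (hasDerivAt_update p.2.2 j (p.2.2 j)) l).const_mul _).mul_const _
  rw [h.deriv]
  simp [Pi.single_apply]

theorem fderiv_Φ_apply (p v : J1 n) :
    fderiv ℝ c.Φ p v = (c.dτ p.1 * v.1, fun k => ∑ j, c.Jac k j p.2.1 * v.2.1 j,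
      fun k => fderiv ℝ (fun q => c.yc q k) p v) := by
  have h1 : HasFDerivAt (fun q : J1 n => c.τ q.1) _ p := HasDerivAt.comp_hasFDerivAt p
    (c.smooth_τ.differentiable (by simp) p.1).hasDerivAt
    (hasFDerivAt_fst (𝕜 := ℝ) (p := p))
  have h2 : HasFDerivAt (fun q : J1 n => c.σ q.2.1) _ p := hasFDerivAt_pi.2 fun k =>
    (((contDiff_comp_σ c k).comp (contDiff_fst.comp contDiff_snd)).differentiable
      (by simp) p).hasFDerivAt
  have h3 : HasFDerivAt c.yc _ p := hasFDerivAt_pi.2 fun k =>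
    ((contDiff_yc c k).differentiable (by simp) p).hasFDerivAt
  have h : HasFDerivAt c.Φ _ p := h1.prodMk (h2.prodMk h3)
  rw [h.fderiv]
  refine Prod.ext ?_ (Prod.ext (funext fun k => ?_) rfl)
  · simp [CoordChange.dτ]
  · exact fderiv_comp_space (contDiff_comp_σ c k) p v

theorem fderiv_Φ_frameT {M M' : J1 n → Fin n → ℝ} (law : TemporalNLCLaw c M M') (p : J1 n) :
    fderiv ℝ c.Φ p (frameT M p) = c.dτ p.1 • frameT M' (c.Φ p) := by
  rw [fderiv_Φ_apply]
  refine Prod.ext ?_ (Prod.ext (funext fun k => ?_) (funext fun k => ?_))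
  · simp [frameT]
  · simp [frameT]
  · have h := law p k
    simp only [← deltaT_eq_fderiv ((contDiff_yc c k).differentiable (by simp) p)]
    simp only [deltaT, py_yc, frameT, Prod.smul_snd, Pi.smul_apply, smul_eq_mul]
    rw [mul_neg, mul_comm (c.dτ p.1), h, neg_sub]
    exact congrArg _ (Finset.sum_congr rfl fun j _ => by ring)

theorem fderiv_Φ_frameX {N N' : J1 n → Fin n → Fin n → ℝ} (law : SpatialNLCLaw c N N')
    (i : Fin n) (p : J1 n) :
    fderiv ℝ c.Φ p (frameX N i p) = ∑ j, c.Jac j i p.2.1 • frameX N' j (c.Φ p) := by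
  rw [fderiv_Φ_apply]
  refine Prod.ext ?_ (Prod.ext (funext fun k => ?_) (funext fun k => ?_))
  · simp [frameX, Prod.fst_sum]
  · simp [frameX, Prod.fst_sum, Prod.snd_sum, Pi.single_apply]
  · have h := law p k i
    simp only [← deltaX_eq_fderiv ((contDiff_yc c k).differentiable (by simp) p)]
    simp only [deltaX, py_yc, frameX, Prod.snd_sum, Prod.smul_snd, Finset.sum_apply, Pi.smul_apply, smul_eq_mul,
      mul_neg, Finset.sum_neg_distrib]
    rw [show ∑ j, c.Jac j i p.2.1 * N' (c.Φ p) k j = ∑ j, N' (c.Φ p) k j * c.Jac j i p.2.1 from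
      Finset.sum_congr rfl fun j _ => mul_comm _ _, h, neg_sub]
    exact congrArg _ (Finset.sum_congr rfl fun j _ => by ring)

theorem fderiv_Φ_frameY (i : Fin n) (p : J1 n) :
    fderiv ℝ c.Φ p (frameY i) = ∑ j, (c.Jac j i p.2.1 * c.dτinv p.1) • frameY j := by
  rw [fderiv_Φ_apply]
  refine Prod.ext ?_ (Prod.ext (funext fun k => ?_) (funext fun k => ?_))
  · simp [frameY, Prod.fst_sum]
  · simp [frameY, Prod.fst_sum, Prod.snd_sum]
  · simp only [frameY, ← py_eq_fderiv ((contDiff_yc c k).differentiable (by simp) p), py_yc]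
    simp [Prod.snd_sum, Pi.single_apply]

end Coordinates

section CovariantDerivative

variable {n : ℕ}

/-- The covariant derivative at `p`, in adapted components, along a tangent vector `v`
(in standard components), with connection matrices `g`, `G`, `H`. -/
def covAlong (g : ℝ) (G H : Fin n → Fin n → ℝ) (v : J1 n) (W : J1 n → J1 n) (p : J1 n) : J1 n :=
  (fderiv ℝ (fun q => (W q).1) p v + (W p).1 * g,
   fun k => fderiv ℝ (fun q => (W q).2.1 k) p v + ∑ i, (W p).2.1 i * G k i,
   fun k => fderiv ℝ (fun q => (W q).2.2 k) p v + ∑ i, (W p).2.2 i * H k i)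

theorem differentiable_fst {W : J1 n → J1 n} (hW : Differentiable ℝ W) :
    Differentiable ℝ (fun q => (W q).1) := hW.fst

theorem differentiable_snd_fst {W : J1 n → J1 n} (hW : Differentiable ℝ W) (k : Fin n) :
    Differentiable ℝ (fun q => (W q).2.1 k) := by fun_prop

theorem differentiable_snd_snd {W : J1 n → J1 n} (hW : Differentiable ℝ W) (k : Fin n) :
    Differentiable ℝ (fun q => (W q).2.2 k) := by fun_prop

theorem covT_eq_covAlong (M : J1 n → Fin n → ℝ) (Γ : GammaCoeffs n) {W : J1 n → J1 n}
    (hW : Differentiable ℝ W) (p : J1 n) :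
    covT M Γ W p = covAlong (Γ.Gbar p) (Γ.Gc p) (Γ.Gv p) (frameT M p) W p := by
  simp only [covT, covAlong, deltaT_eq_fderiv (differentiable_fst hW p),
    deltaT_eq_fderiv (differentiable_snd_fst hW _ p),
    deltaT_eq_fderiv (differentiable_snd_snd hW _ p)]

theorem covX_eq_covAlong (N : J1 n → Fin n → Fin n → ℝ) (Γ : GammaCoeffs n) {W : J1 n → J1 n}
    (hW : Differentiable ℝ W) (j : Fin n) (p : J1 n) :
    covX N Γ W j p = covAlong (Γ.Lbar p j) (fun k i => Γ.Lc p k i j) (fun k i => Γ.Lv p k i j)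
      (frameX N j p) W p := by
  simp only [covX, covAlong, deltaX_eq_fderiv (differentiable_fst hW p),
    deltaX_eq_fderiv (differentiable_snd_fst hW _ p),
    deltaX_eq_fderiv (differentiable_snd_snd hW _ p)]

theorem covY_eq_covAlong (Γ : GammaCoeffs n) {W : J1 n → J1 n}
    (hW : Differentiable ℝ W) (j : Fin n) (p : J1 n) :
    covY Γ W j p = covAlong (Γ.Cbar p j) (fun k i => Γ.Cc p k i j) (fun k i => Γ.Cv p k i j)
      (frameY j) W p := by
  simp only [covY, covAlong, py_eq_fderiv (differentiable_fst hW p),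
    py_eq_fderiv (differentiable_snd_fst hW _ p),
    py_eq_fderiv (differentiable_snd_snd hW _ p), frameY]

theorem smul_covAlong (a g : ℝ) (G H : Fin n → Fin n → ℝ) (v : J1 n) (W : J1 n → J1 n)
    (p : J1 n) :
    a • covAlong g G H v W p =
      covAlong (a * g) (fun k i => a * G k i) (fun k i => a * H k i) (a • v) W p := by
  refine Prod.ext ?_ (Prod.ext (funext fun k => ?_) (funext fun k => ?_)) <;>
  simp [covAlong, mul_add, Finset.mul_sum, mul_left_comm]

theorem sum_covAlong (g : Fin n → ℝ) (G H : Fin n → Fin n → Fin n → ℝ) (v : Fin n → J1 n)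
    (W : J1 n → J1 n) (p : J1 n) :
    ∑ j, covAlong (g j) (G j) (H j) (v j) W p =
      covAlong (∑ j, g j) (fun k i => ∑ j, G j k i) (fun k i => ∑ j, H j k i) (∑ j, v j) W p := by
  refine Prod.ext ?_ (Prod.ext (funext fun k => ?_) (funext fun k => ?_))
  · simp only [covAlong, Prod.fst_sum, map_sum, Finset.sum_add_distrib, Finset.mul_sum]
  · simp only [covAlong, Prod.fst_sum, Prod.snd_sum, Finset.sum_apply, map_sum,
      Finset.sum_add_distrib, Finset.mul_sum]
    rw [Finset.sum_comm (γ := Fin n) (f := fun j i => (W p).2.1 i * G j k i)]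
  · simp only [covAlong, Prod.snd_sum, Finset.sum_apply, map_sum,
      Finset.sum_add_distrib, Finset.mul_sum]
    rw [Finset.sum_comm (γ := Fin n) (f := fun j i => (W p).2.2 i * H j k i)]

theorem fderiv_sum_mul {A : Fin n → J1 n → ℝ} {w : Fin n → J1 n → ℝ}
    (hA : ∀ i, Differentiable ℝ (A i)) (hw : ∀ i, Differentiable ℝ (w i)) (p v : J1 n) :
    fderiv ℝ (fun q => ∑ i, A i q * w i q) p v =
      ∑ i, (fderiv ℝ (A i) p v * w i p + A i p * fderiv ℝ (w i) p v) := by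
  have h : HasFDerivAt (fun q => ∑ i, A i q * w i q)
      (∑ i, (A i p • fderiv ℝ (w i) p + w i p • fderiv ℝ (A i) p)) p :=
    HasFDerivAt.fun_sum fun i _ => (hA i p).hasFDerivAt.mul (hw i p).hasFDerivAt
  rw [h.fderiv]
  simp only [sum_apply, add_apply,
    smul_apply, smul_eq_mul]
  exact Finset.sum_congr rfl fun i _ => by ring

/-- The defect of a gauge transformation `A` (with derivative `dA`) intertwining two
connection matrices `G`, `G'` is tensorial. -/
theorem gauge_defect (A dA G G' : Fin n → Fin n → ℝ) (w dw : Fin n → ℝ) (k : Fin n) :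
    ∑ i, A k i * (dw i + ∑ s, w s * G i s) -
      (∑ i, (dA k i * w i + A k i * dw i) + ∑ r, (∑ s, A r s * w s) * G' k r) =
    ∑ s, (∑ m, A k m * G m s - (dA k s + ∑ r, A r s * G' k r)) * w s := by
  simp only [mul_add, sub_mul, add_mul, Finset.sum_add_distrib, Finset.sum_sub_distrib,
    Finset.mul_sum, Finset.sum_mul]
  rw [Finset.sum_comm (γ := Fin n) (f := fun s m => A k m * G m s * w s),
    Finset.sum_comm (γ := Fin n) (f := fun s r => A r s * G' k r * w s)]
  simp only [mul_comm, mul_left_comm]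
  ring

theorem gauge_iff (A dA G G' : Fin n → Fin n → ℝ) (k : Fin n) (w dw : Fin n → ℝ)
    (h : ∀ s, ∑ m, A k m * G m s = dA k s + ∑ r, A r s * G' k r) :
    ∑ i, A k i * (dw i + ∑ s, w s * G i s) =
      ∑ i, (dA k i * w i + A k i * dw i) + ∑ r, (∑ s, A r s * w s) * G' k r := by
  rw [← sub_eq_zero, gauge_defect]
  exact Finset.sum_eq_zero fun s _ => by rw [h s, sub_self, zero_mul]

theorem gauge_of_single (A dA G G' : Fin n → Fin n → ℝ) (k s : Fin n) (dw : Fin n → ℝ)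
    (h : ∑ i, A k i * (dw i + ∑ s', (Pi.single s 1 : Vec n) s' * G i s') =
      ∑ i, (dA k i * (Pi.single s 1 : Vec n) i + A k i * dw i) +
        ∑ r, (∑ s', A r s' * (Pi.single s 1 : Vec n) s') * G' k r) :
    ∑ m, A k m * G m s = dA k s + ∑ r, A r s * G' k r := by
  rw [← sub_eq_zero, gauge_defect] at h
  simpa [Pi.single_apply, sub_eq_zero] using h

variable (c : CoordChange n)

theorem fderiv_pushVF {W : J1 n → J1 n} (hW : ContDiff ℝ (⊤ : ℕ∞) W) (L : J1 n →L[ℝ] ℝ)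
    (p v : J1 n) :
    fderiv ℝ (fun q => L (pushVF c W q)) (c.Φ p) (fderiv ℝ c.Φ p v) =
      fderiv ℝ (fun q => L (adMap c q (W q))) p v := by
  have hL : Differentiable ℝ (fun q => L (pushVF c W q)) :=
    L.differentiable.comp ((contDiff_pushVF c hW).differentiable (by simp))
  have h := fderiv_comp p (hL (c.Φ p)) ((contDiff_Φ c).differentiable (by simp) p)
  rw [← ContinuousLinearMap.comp_apply, ← h]
  congr 2
  funext q
  simp [pushVF_Φ]

/-- The covariant derivatives along `v`, with connection matrices `g, G, H` in the old chart
and `g', G', H'` in the new one, correspond under the coordinate change. -/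
def CovAgree (p v : J1 n) (g : ℝ) (G H : Fin n → Fin n → ℝ) (g' : ℝ)
    (G' H' : Fin n → Fin n → ℝ) : Prop :=
  ∀ W : J1 n → J1 n, ContDiff ℝ (⊤ : ℕ∞) W →
    adMap c p (covAlong g G H v W p) =
      covAlong g' G' H' (fderiv ℝ c.Φ p v) (pushVF c W) (c.Φ p)

theorem covAlong_pushVF (p v : J1 n) (g' : ℝ) (G' H' : Fin n → Fin n → ℝ) {W : J1 n → J1 n}
    (hW : ContDiff ℝ (⊤ : ℕ∞) W) :
    covAlong g' G' H' (fderiv ℝ c.Φ p v) (pushVF c W) (c.Φ p) =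
      (d2τ c p.1 * v.1 * (W p).1 + c.dτ p.1 * fderiv ℝ (fun q => (W q).1) p v +
          c.dτ p.1 * (W p).1 * g',
       fun k => ∑ i, ((∑ j, d2σ c k i j p.2.1 * v.2.1 j) * (W p).2.1 i +
            c.Jac k i p.2.1 * fderiv ℝ (fun q => (W q).2.1 i) p v) +
          ∑ r, (∑ s, c.Jac r s p.2.1 * (W p).2.1 s) * G' k r,
       fun k => ∑ i, (((∑ j, d2σ c k i j p.2.1 * v.2.1 j) * c.dτinv p.1 +
            c.Jac k i p.2.1 * (d2τinv c p.1 * c.dτ p.1 * v.1)) * (W p).2.2 i +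
            c.Jac k i p.2.1 * c.dτinv p.1 * fderiv ℝ (fun q => (W q).2.2 i) p v) +
          ∑ r, (∑ s, c.Jac r s p.2.1 * c.dτinv p.1 * (W p).2.2 s) * H' k r) := by
  have hd : Differentiable ℝ W := hW.differentiable (by simp)
  have hJ : ∀ k i, Differentiable ℝ (fun q : J1 n => c.Jac k i q.2.1) := fun k i =>
    ((contDiff_Jac c k i).comp (contDiff_fst.comp contDiff_snd)).differentiable (by simp)
  have hτ : Differentiable ℝ (fun q : J1 n => c.dτ q.1) :=
    ((contDiff_dτ c).comp contDiff_fst).differentiable (by simp)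
  have hτi : Differentiable ℝ (fun q : J1 n => c.dτinv q.1) :=
    ((contDiff_dτinv c).comp contDiff_fst).differentiable (by simp)
  let pr1 : J1 n →L[ℝ] Vec n :=
    (ContinuousLinearMap.fst ℝ _ _).comp (ContinuousLinearMap.snd ℝ _ _)
  let pr2 : J1 n →L[ℝ] Vec n :=
    (ContinuousLinearMap.snd ℝ _ _).comp (ContinuousLinearMap.snd ℝ _ _)
  refine Prod.ext ?_ (Prod.ext (funext fun k => ?_) (funext fun k => ?_))
  · have h := fderiv_pushVF c hW (ContinuousLinearMap.fst ℝ _ _) p v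
    simp only [ContinuousLinearMap.coe_fst'] at h
    simp only [covAlong, h, pushVF_Φ, adMap]
    rw [fderiv_fun_mul (hτ p) (differentiable_fst hd p)]
    simp only [add_apply, smul_apply, smul_eq_mul,
      fderiv_dτ]
    ring
  · have h := fderiv_pushVF c hW ((ContinuousLinearMap.proj k).comp pr1) p v
    simp only [pr1, ContinuousLinearMap.comp_apply, ContinuousLinearMap.coe_fst',
      ContinuousLinearMap.coe_snd', ContinuousLinearMap.proj_apply] at h
    simp only [covAlong, h, pushVF_Φ, adMap]
    rw [fderiv_sum_mul (fun i => hJ k i) (fun i => differentiable_snd_fst hd i)]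
    simp only [fderiv_Jac]
  · have h := fderiv_pushVF c hW ((ContinuousLinearMap.proj k).comp pr2) p v
    simp only [pr2, ContinuousLinearMap.comp_apply,
      ContinuousLinearMap.coe_snd', ContinuousLinearMap.proj_apply] at h
    simp only [covAlong, h, pushVF_Φ, adMap]
    rw [fderiv_sum_mul (A := fun i q => c.Jac k i q.2.1 * c.dτinv q.1)
      (fun i => (hJ k i).mul hτi) (fun i => differentiable_snd_snd hd i)]
    congr 1
    refine Finset.sum_congr rfl fun i _ => ?_
    rw [fderiv_fun_mul (hJ k i p) (hτi p)]
    simp only [add_apply, smul_apply, smul_eq_mul,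
      fderiv_Jac, fderiv_dτinv]
    ring

theorem covAgree_iff (p v : J1 n) (g : ℝ) (G H : Fin n → Fin n → ℝ) (g' : ℝ)
    (G' H' : Fin n → Fin n → ℝ) :
    CovAgree c p v g G H g' G' H' ↔
      c.dτ p.1 * g = d2τ c p.1 * v.1 + c.dτ p.1 * g' ∧
      (∀ k s, ∑ m, c.Jac k m p.2.1 * G m s =
        ∑ j, d2σ c k s j p.2.1 * v.2.1 j + ∑ r, c.Jac r s p.2.1 * G' k r) ∧
      (∀ k s, ∑ m, c.Jac k m p.2.1 * c.dτinv p.1 * H m s =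
        ((∑ j, d2σ c k s j p.2.1 * v.2.1 j) * c.dτinv p.1 +
            c.Jac k s p.2.1 * (d2τinv c p.1 * c.dτ p.1 * v.1)) +
          ∑ r, c.Jac r s p.2.1 * c.dτinv p.1 * H' k r) := by
  constructor
  · intro h
    refine ⟨?_, fun k s => ?_, fun k s => ?_⟩
    · have h1 := h (fun _ => (1, 0, 0)) contDiff_const
      rw [covAlong_pushVF c p v g' G' H' contDiff_const] at h1
      simpa [adMap, covAlong] using congrArg Prod.fst h1
    · have h1 := h (fun _ => (0, Pi.single s 1, 0)) contDiff_const
      rw [covAlong_pushVF c p v g' G' H' contDiff_const] at h1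
      exact gauge_of_single (fun k i => c.Jac k i p.2.1)
        (fun k i => ∑ j, d2σ c k i j p.2.1 * v.2.1 j) G G' k s _
        (congrFun (congrArg (fun w => w.2.1) h1) k)
    · have h1 := h (fun _ => (0, 0, Pi.single s 1)) contDiff_const
      rw [covAlong_pushVF c p v g' G' H' contDiff_const] at h1
      exact gauge_of_single (fun k i => c.Jac k i p.2.1 * c.dτinv p.1)
        (fun k i => (∑ j, d2σ c k i j p.2.1 * v.2.1 j) * c.dτinv p.1 +
            c.Jac k i p.2.1 * (d2τinv c p.1 * c.dτ p.1 * v.1)) H H' k s _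
        (congrFun (congrArg (fun w => w.2.2) h1) k)
  · rintro ⟨h1, h2, h3⟩ W hW
    rw [covAlong_pushVF c p v g' G' H' hW]
    refine Prod.ext ?_ (Prod.ext (funext fun k => ?_) (funext fun k => ?_))
    · simp only [adMap, covAlong]
      linear_combination (W p).1 * h1
    · exact gauge_iff (fun k i => c.Jac k i p.2.1)
        (fun k i => ∑ j, d2σ c k i j p.2.1 * v.2.1 j) G G' k _ _ (h2 k)
    · exact gauge_iff (fun k i => c.Jac k i p.2.1 * c.dτinv p.1)
        (fun k i => (∑ j, d2σ c k i j p.2.1 * v.2.1 j) * c.dτinv p.1 +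
            c.Jac k i p.2.1 * (d2τinv c p.1 * c.dτ p.1 * v.1)) H H' k _ _ (h3 k)

theorem sameConnection_iff_covAgree {M M' : J1 n → Fin n → ℝ}
    {N N' : J1 n → Fin n → Fin n → ℝ} (lawM : TemporalNLCLaw c M M')
    (lawN : SpatialNLCLaw c N N') (Γ Γ' : GammaCoeffs n) :
    SameConnection c M N M' N' Γ Γ' ↔
      (∀ p, CovAgree c p (frameT M p) (Γ.Gbar p) (Γ.Gc p) (Γ.Gv p)
        (c.dτ p.1 * Γ'.Gbar (c.Φ p)) (fun k i => c.dτ p.1 * Γ'.Gc (c.Φ p) k i)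
        (fun k i => c.dτ p.1 * Γ'.Gv (c.Φ p) k i)) ∧
      (∀ p i, CovAgree c p (frameX N i p) (Γ.Lbar p i) (fun k s => Γ.Lc p k s i)
        (fun k s => Γ.Lv p k s i) (∑ j, c.Jac j i p.2.1 * Γ'.Lbar (c.Φ p) j)
        (fun k s => ∑ j, c.Jac j i p.2.1 * Γ'.Lc (c.Φ p) k s j)
        (fun k s => ∑ j, c.Jac j i p.2.1 * Γ'.Lv (c.Φ p) k s j)) ∧
      (∀ p i, CovAgree c p (frameY i) (Γ.Cbar p i) (fun k s => Γ.Cc p k s i)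
        (fun k s => Γ.Cv p k s i)
        (∑ j, c.Jac j i p.2.1 * c.dτinv p.1 * Γ'.Cbar (c.Φ p) j)
        (fun k s => ∑ j, c.Jac j i p.2.1 * c.dτinv p.1 * Γ'.Cc (c.Φ p) k s j)
        (fun k s => ∑ j, c.Jac j i p.2.1 * c.dτinv p.1 * Γ'.Cv (c.Φ p) k s j)) := by
  have key : ∀ W : J1 n → J1 n, ContDiff ℝ (⊤ : ℕ∞) W →
      Differentiable ℝ W ∧ Differentiable ℝ (pushVF c W) := fun W hW =>
    ⟨hW.differentiable (by simp), (contDiff_pushVF c hW).differentiable (by simp)⟩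
  constructor
  · intro h
    refine ⟨fun p W hW => ?_, fun p i W hW => ?_, fun p i W hW => ?_⟩ <;>
    obtain ⟨h1, h2⟩ := key W hW
    · have := (h W hW).1 p
      rwa [covT_eq_covAlong M Γ h1, covT_eq_covAlong M' Γ' h2, smul_covAlong,
        ← fderiv_Φ_frameT c lawM] at this
    · have := (h W hW).2.1 p i
      simpa only [covX_eq_covAlong N Γ h1, covX_eq_covAlong N' Γ' h2, smul_covAlong,
        sum_covAlong, ← fderiv_Φ_frameX c lawN] using this
    · have := (h W hW).2.2 p i
      simpa only [covY_eq_covAlong Γ h1, covY_eq_covAlong Γ' h2, smul_covAlong,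
        sum_covAlong, ← fderiv_Φ_frameY c] using this
  · rintro ⟨hT, hX, hY⟩ W hW
    obtain ⟨h1, h2⟩ := key W hW
    refine ⟨fun p => ?_, fun p i => ?_, fun p i => ?_⟩
    · rw [covT_eq_covAlong M Γ h1, covT_eq_covAlong M' Γ' h2, smul_covAlong,
        ← fderiv_Φ_frameT c lawM]
      exact hT p W hW
    · simpa only [covX_eq_covAlong N Γ h1, covX_eq_covAlong N' Γ' h2, smul_covAlong,
        sum_covAlong, ← fderiv_Φ_frameX c lawN] using hX p i W hW
    · simpa only [covY_eq_covAlong Γ h1, covY_eq_covAlong Γ' h2, smul_covAlong,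
        sum_covAlong, ← fderiv_Φ_frameY c] using hY p i W hW

end CovariantDerivative

section Algebra

variable {n : ℕ} (c : CoordChange n)

theorem Jac_mul_JacInv (x : Vec n) :
    (Matrix.of fun i j => c.Jac i j x) * (Matrix.of fun i j => c.JacInv i j x) = 1 :=
  mul_eq_one_comm.1 (JacInv_mul_Jac c x)

theorem gauge_iff_conj (x : Vec n) (e : ℝ) (G G' : Fin n → Fin n → ℝ) :
    (∀ k s, ∑ m, c.Jac k m x * G m s = c.Jac k s x * e + ∑ r, c.Jac r s x * G' k r) ↔
      ∀ k i, G k i = (∑ m, ∑ j, G' m j * c.JacInv k m x * c.Jac j i x) +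
        (if k = i then 1 else 0) * e := by
  set J := Matrix.of fun i j => c.Jac i j x with hJ
  set I := Matrix.of fun i j => c.JacInv i j x with hI
  have hIJ : I * J = 1 := JacInv_mul_Jac c x
  have hJI : J * I = 1 := Jac_mul_JacInv c x
  have h1 : (∀ k s, ∑ m, c.Jac k m x * G m s =
      c.Jac k s x * e + ∑ r, c.Jac r s x * G' k r) ↔
      J * Matrix.of G = e • J + Matrix.of G' * J := by
    simp [← Matrix.ext_iff, Matrix.mul_apply, hJ, mul_comm]
  have h2 : (∀ k i, G k i = (∑ m, ∑ j, G' m j * c.JacInv k m x * c.Jac j i x) +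
      (if k = i then 1 else 0) * e) ↔
      Matrix.of G = I * (Matrix.of G' * J) + e • (1 : Matrix (Fin n) (Fin n) ℝ) := by
    simp [← Matrix.ext_iff, Matrix.mul_apply, hJ, hI, Matrix.one_apply, Finset.mul_sum,
      mul_assoc, mul_left_comm]
  rw [h1, h2]
  constructor
  · intro h
    rw [← one_mul (Matrix.of G), ← hIJ, mul_assoc, h, mul_add, mul_smul_comm, add_comm]
  · intro h
    rw [h, mul_add, ← mul_assoc, hJI, one_mul, mul_smul_comm, mul_one, add_comm]

theorem covector_iff (x : Vec n) (L L' : Fin n → ℝ) :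
    (∀ i, L i = ∑ j, c.Jac j i x * L' j) ↔ ∀ l, ∑ j, L j * c.JacInv j l x = L' l := by
  set J := Matrix.of fun i j => c.Jac i j x with hJ
  set I := Matrix.of fun i j => c.JacInv i j x with hI
  have h1 : (∀ i, L i = ∑ j, c.Jac j i x * L' j) ↔ L = Matrix.vecMul L' J := by
    simp [funext_iff, Matrix.vecMul, dotProduct, hJ, mul_comm]
  have h2 : (∀ l, ∑ j, L j * c.JacInv j l x = L' l) ↔ Matrix.vecMul L I = L' := by
    simp [funext_iff, Matrix.vecMul, dotProduct, hI]
  rw [h1, h2]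
  constructor
  · rintro rfl
    rw [Matrix.vecMul_vecMul, Jac_mul_JacInv, Matrix.vecMul_one]
  · rintro rfl
    rw [Matrix.vecMul_vecMul, JacInv_mul_Jac, Matrix.vecMul_one]

theorem dτ_ne_zero (t : ℝ) : c.dτ t ≠ 0 := right_ne_zero_of_mul_eq_one (dτinv_mul_dτ c t)

theorem dτinv_ne_zero (t : ℝ) : c.dτinv t ≠ 0 := left_ne_zero_of_mul_eq_one (dτinv_mul_dτ c t)

variable (Γ Γ' : GammaCoeffs n) (p : J1 n)

theorem covAgree_frameT_iff (M : J1 n → Fin n → ℝ) :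
    CovAgree c p (frameT M p) (Γ.Gbar p) (Γ.Gc p) (Γ.Gv p)
        (c.dτ p.1 * Γ'.Gbar (c.Φ p)) (fun k i => c.dτ p.1 * Γ'.Gc (c.Φ p) k i)
        (fun k i => c.dτ p.1 * Γ'.Gv (c.Φ p) k i) ↔
      (Γ.Gbar p * c.dτ p.1 = Γ'.Gbar (c.Φ p) * (c.dτ p.1) ^ 2 + d2τ c p.1) ∧
      (∀ k i, Γ.Gc p k i =
        ∑ m, ∑ j, Γ'.Gc (c.Φ p) m j * c.JacInv k m p.2.1 * c.Jac j i p.2.1 * c.dτ p.1) ∧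
      (∀ k i, Γ.Gv p k i =
        (∑ m, ∑ j, Γ'.Gv (c.Φ p) m j * c.JacInv k m p.2.1 * c.Jac j i p.2.1 * c.dτ p.1) +
          (if k = i then 1 else 0) * (c.dτ p.1) ^ 2 * d2τinv c p.1) := by
  rw [covAgree_iff]
  refine and_congr ?_ (and_congr ?_ ?_)
  · simp only [frameT]
    constructor <;> intro h <;> linear_combination h
  · have h := gauge_iff_conj c p.2.1 0 (Γ.Gc p) (fun k i => c.dτ p.1 * Γ'.Gc (c.Φ p) k i)
    simp only [mul_zero, zero_add, add_zero] at h
    simp only [frameT, Pi.zero_apply, mul_zero, Finset.sum_const_zero, zero_add, h]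
    simp only [mul_comm, mul_left_comm]
  · have h := gauge_iff_conj c p.2.1 ((c.dτ p.1) ^ 2 * d2τinv c p.1) (Γ.Gv p)
      (fun k i => c.dτ p.1 * Γ'.Gv (c.Φ p) k i)
    have hb := dτinv_mul_dτ c p.1
    refine Iff.trans (Iff.trans ?_ h) (forall_congr' fun k => forall_congr' fun i => ?_)
    swap
    · simp only [mul_assoc, mul_comm (c.dτ p.1)]
    refine forall_congr' fun k => forall_congr' fun s => ?_
    rw [← mul_right_inj' (dτinv_ne_zero c p.1) (b := ∑ m, c.Jac k m p.2.1 * Γ.Gv p m s)]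
    simp only [frameT, Pi.zero_apply, mul_zero, Finset.sum_const_zero, zero_mul, zero_add,
      mul_one]
    have e1 : ∑ m, c.Jac k m p.2.1 * c.dτinv p.1 * Γ.Gv p m s =
        c.dτinv p.1 * ∑ m, c.Jac k m p.2.1 * Γ.Gv p m s := by
      rw [Finset.mul_sum]
      exact Finset.sum_congr rfl fun m _ => by ring
    have e2 : ∑ r, c.Jac r s p.2.1 * c.dτinv p.1 * (c.dτ p.1 * Γ'.Gv (c.Φ p) k r) =
        c.dτinv p.1 * ∑ r, c.Jac r s p.2.1 * (c.dτ p.1 * Γ'.Gv (c.Φ p) k r) := by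
      rw [Finset.mul_sum]
      exact Finset.sum_congr rfl fun m _ => by ring
    have e3 : c.dτinv p.1 * (c.Jac k s p.2.1 * ((c.dτ p.1) ^ 2 * d2τinv c p.1)) =
        c.Jac k s p.2.1 * (d2τinv c p.1 * c.dτ p.1) := by
      linear_combination c.Jac k s p.2.1 * (d2τinv c p.1 * c.dτ p.1) * hb
    rw [e1, e2, mul_add, e3]

theorem gauge_frameX_iff (x : Vec n) (L L' : Fin n → Fin n → Fin n → ℝ) (r i j : Fin n) :
    (∑ m, c.Jac r m x * L m i j = ∑ l, d2σ c r i l x * (Pi.single j 1 : Vec n) l +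
        ∑ s, c.Jac s i x * ∑ q, c.Jac q j x * L' r s q) ↔
      (∑ m, L m i j * c.Jac r m x) =
        (∑ s, ∑ q, L' r s q * c.Jac s i x * c.Jac q j x) + d2σ c r i j x := by
  have e1 : ∑ m, c.Jac r m x * L m i j = ∑ m, L m i j * c.Jac r m x :=
    Finset.sum_congr rfl fun m _ => mul_comm _ _
  have e2 : ∑ s, c.Jac s i x * ∑ q, c.Jac q j x * L' r s q =
      ∑ s, ∑ q, L' r s q * c.Jac s i x * c.Jac q j x := by
    refine Finset.sum_congr rfl fun s _ => ?_
    rw [Finset.mul_sum]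
    exact Finset.sum_congr rfl fun q _ => by ring
  have e3 : ∑ l, d2σ c r i l x * (Pi.single j 1 : Vec n) l = d2σ c r i j x := by
    simp [Pi.single_apply]
  rw [e1, e2, e3, add_comm]

theorem covAgree_frameX_iff (N : J1 n → Fin n → Fin n → ℝ) (i : Fin n) :
    CovAgree c p (frameX N i p) (Γ.Lbar p i) (fun k s => Γ.Lc p k s i)
        (fun k s => Γ.Lv p k s i) (∑ j, c.Jac j i p.2.1 * Γ'.Lbar (c.Φ p) j)
        (fun k s => ∑ j, c.Jac j i p.2.1 * Γ'.Lc (c.Φ p) k s j)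
        (fun k s => ∑ j, c.Jac j i p.2.1 * Γ'.Lv (c.Φ p) k s j) ↔
      (Γ.Lbar p i = ∑ j, c.Jac j i p.2.1 * Γ'.Lbar (c.Φ p) j) ∧
      (∀ r s, (∑ m, Γ.Lc p m s i * c.Jac r m p.2.1) =
        (∑ l, ∑ q, Γ'.Lc (c.Φ p) r l q * c.Jac l s p.2.1 * c.Jac q i p.2.1) +
          d2σ c r s i p.2.1) ∧
      (∀ r s, (∑ m, Γ.Lv p m s i * c.Jac r m p.2.1) =
        (∑ l, ∑ q, Γ'.Lv (c.Φ p) r l q * c.Jac l s p.2.1 * c.Jac q i p.2.1) +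
          d2σ c r s i p.2.1) := by
  rw [covAgree_iff]
  refine and_congr ?_ (and_congr ?_ ?_)
  · simp [frameX, dτ_ne_zero]
  · exact forall_congr' fun r => forall_congr' fun s =>
      gauge_frameX_iff c p.2.1 (Γ.Lc p) (Γ'.Lc (c.Φ p)) r s i
  · refine forall_congr' fun r => forall_congr' fun s => ?_
    rw [← gauge_frameX_iff c p.2.1 (Γ.Lv p) (Γ'.Lv (c.Φ p)) r s i,
      ← mul_right_inj' (dτinv_ne_zero c p.1) (b := ∑ m, c.Jac r m p.2.1 * Γ.Lv p m s i)]
    simp only [frameX, mul_zero, add_zero, mul_right_comm _ (c.dτinv p.1), ← Finset.sum_mul,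
      ← add_mul]
    rw [mul_comm (c.dτinv p.1), mul_comm (c.dτinv p.1)]

theorem gauge_frameY_iff (K K' : Fin n → Fin n → Fin n → ℝ) (j : Fin n) :
    (∀ k s, ∑ m, c.Jac k m p.2.1 * K m s j =
        ∑ r, c.Jac r s p.2.1 * ∑ q, c.Jac q j p.2.1 * c.dτinv p.1 * K' k r q) ↔
      ∀ k i, K k i j = ∑ s, ∑ q, ∑ r, K' s q r * c.JacInv k s p.2.1 * c.Jac q i p.2.1 *
        c.Jac r j p.2.1 * c.dτinv p.1 := by
  have h := gauge_iff_conj c p.2.1 0 (fun k s => K k s j)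
    (fun k r => ∑ q, c.Jac q j p.2.1 * c.dτinv p.1 * K' k r q)
  simp only [mul_zero, zero_add, add_zero] at h
  rw [h]
  refine forall_congr' fun k => forall_congr' fun i => ?_
  rw [Finset.sum_congr rfl fun m _ => Finset.sum_congr rfl fun q _ => ?_]
  rw [Finset.sum_mul, Finset.sum_mul]
  exact Finset.sum_congr rfl fun r _ => by ring

theorem covAgree_frameY_iff (i : Fin n) :
    CovAgree c p (frameY i) (Γ.Cbar p i) (fun k s => Γ.Cc p k s i)
        (fun k s => Γ.Cv p k s i)
        (∑ j, c.Jac j i p.2.1 * c.dτinv p.1 * Γ'.Cbar (c.Φ p) j)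
        (fun k s => ∑ j, c.Jac j i p.2.1 * c.dτinv p.1 * Γ'.Cc (c.Φ p) k s j)
        (fun k s => ∑ j, c.Jac j i p.2.1 * c.dτinv p.1 * Γ'.Cv (c.Φ p) k s j) ↔
      (Γ.Cbar p i = ∑ j, Γ'.Cbar (c.Φ p) j * c.Jac j i p.2.1 * c.dτinv p.1) ∧
      (∀ k s, Γ.Cc p k s i =
        ∑ l, ∑ q, ∑ r, Γ'.Cc (c.Φ p) l q r * c.JacInv k l p.2.1 * c.Jac q s p.2.1 *
          c.Jac r i p.2.1 * c.dτinv p.1) ∧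
      (∀ k s, Γ.Cv p k s i =
        ∑ l, ∑ q, ∑ r, Γ'.Cv (c.Φ p) l q r * c.JacInv k l p.2.1 * c.Jac q s p.2.1 *
          c.Jac r i p.2.1 * c.dτinv p.1) := by
  rw [covAgree_iff]
  refine and_congr ?_ (and_congr ?_ ?_)
  · simp only [frameY, mul_zero, zero_add, mul_right_inj' (dτ_ne_zero c p.1)]
    rw [Finset.sum_congr rfl fun j _ => ?_]
    ring
  · rw [← gauge_frameY_iff]
    simp [frameY]
  · rw [← gauge_frameY_iff]
    refine forall_congr' fun k => forall_congr' fun s => ?_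
    rw [← mul_left_inj' (dτinv_ne_zero c p.1) (a := ∑ m, c.Jac k m p.2.1 * Γ.Cv p m s i)]
    simp only [frameY, Pi.zero_apply, mul_zero, zero_mul, zero_add, Finset.sum_const_zero]
    simp only [Finset.sum_mul, mul_right_comm _ (c.dτinv p.1)]

end Algebra

/-- (i) The nine local coefficient families of any `Γ`-linear connection
`∇` on `J¹(ℝ,M)` transform under the induced jet coordinate change by the rules `GammaLaws`.
(ii) Conversely, a set of nine local coefficient families in each chart obeying these
transformation laws determines a (single, well-defined) `Γ`-linear connection on `J¹(ℝ,M)`: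
the locally defined covariant derivatives agree on overlaps. -/
theorem gamma_linear_connection_iff_transformation_laws
    {n : ℕ} (c : CoordChange n)
    (M M' : J1 n → Fin n → ℝ) (N N' : J1 n → Fin n → Fin n → ℝ)
    (lawM : TemporalNLCLaw c M M') (lawN : SpatialNLCLaw c N N')
    (hM : ContDiff ℝ (⊤ : ℕ∞) M) (hM' : ContDiff ℝ (⊤ : ℕ∞) M')
    (hN : ∀ i, ContDiff ℝ (⊤ : ℕ∞) (fun p => N p i)) (hN' : ∀ i, ContDiff ℝ (⊤ : ℕ∞) (fun p => N' p i))
    (Γ Γ' : GammaCoeffs n) (hΓ : SmoothCoeffs Γ) (hΓ' : SmoothCoeffs Γ') :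
    SameConnection c M N M' N' Γ Γ' ↔ GammaLaws c Γ Γ' := by
  rw [sameConnection_iff_covAgree c lawM lawN]
  simp only [covAgree_frameT_iff, covAgree_frameX_iff, covAgree_frameY_iff, forall_and,
    GammaLaws, and_assoc]
  refine and_congr Iff.rfl (and_congr Iff.rfl (and_congr Iff.rfl (and_congr ?_
    (and_congr ?_ (and_congr ?_ (and_congr Iff.rfl (and_congr ?_ ?_)))))))
  · exact forall_congr' fun p => covector_iff c p.2.1 (Γ.Lbar p) (Γ'.Lbar (c.Φ p))
  · exact ⟨fun h p r i j => h p j r i, fun h p j r i => h p r i j⟩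
  · exact ⟨fun h p r i j => h p j r i, fun h p j r i => h p r i j⟩
  · exact ⟨fun h p k i j => h p j k i, fun h p j k i => h p k i j⟩
  · exact ⟨fun h p k i j => h p j k i, fun h p j k i => h p k i j⟩

end Jet
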